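/- Let u, v : Ω → ℝᵈ be divergence-free vector fields on a bounded domain Ω with u, v vanishing (or tangential) on ∂Ω and sufficiently smooth. Then ∫_Ω [(u⊗u):∇v + (v⊗v):∇u] dx = ∫_Ω ((u-v)⊗(u-v)):(∇v)_sym dx, and consequently |∫_Ω [(u⊗u):∇v + (v⊗v):∇u] dx| ≤ ‖(∇v)_sym‖_{L^∞}·‖u - v‖²_{L²}. -/

import Mathlib

open Real MeasureTheory

lemma key18 {d : ℕ} {Ω : Set (EuclideanSpace ℝ (Fin d))}
    (hΩo : IsOpen Ω) (hΩb : Bornology.IsBounded Ω)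
    (f g : EuclideanSpace ℝ (Fin d) → ℝ) (hf : ContDiff ℝ 1 f) (hg : ContDiff ℝ 1 g)
    (f0 : ∀ x ∈ frontier Ω, f x = 0) (g0 : ∀ x ∈ frontier Ω, g x = 0)
    (e : EuclideanSpace ℝ (Fin d)) :
    ∫ x in Ω, (f x * fderiv ℝ g x e + g x * fderiv ℝ f x e) = 0 := by
  classical
  have hbig : ∀ h : EuclideanSpace ℝ (Fin d) → ℝ, Continuous h → IntegrableOn h Ω := by
    intro h hc
    exact (hc.continuousOn.integrableOn_compact hΩb.isCompact_closure).mono_set subset_closure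
  have hcf' : Continuous fun x => fderiv ℝ f x e :=
    (hf.continuous_fderiv one_ne_zero).clm_apply continuous_const
  have hcg' : Continuous fun x => fderiv ℝ g x e :=
    (hg.continuous_fderiv one_ne_zero).clm_apply continuous_const
  have hD : ∀ x, HasFDerivAt (fun y => f y * g y) (f x • fderiv ℝ g x + g x • fderiv ℝ f x) x :=
    fun x => ((hf.differentiable one_ne_zero) x).hasFDerivAt.mul
      ((hg.differentiable one_ne_zero) x).hasFDerivAt
  set P : EuclideanSpace ℝ (Fin d) → ℝ := fun y => f y * g y with hP
  set Q : EuclideanSpace ℝ (Fin d) → ℝ :=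
    fun x => f x * fderiv ℝ g x e + g x * fderiv ℝ f x e with hQ
  have hline : ∀ x, HasLineDerivAt ℝ (Ω.indicator P) (Ω.indicator Q x) x e := by
    intro x
    by_cases hx : x ∈ Ω
    · rw [Set.indicator_of_mem hx]
      have h1 : HasFDerivAt (Ω.indicator P) (f x • fderiv ℝ g x + g x • fderiv ℝ f x) x := by
        refine (hD x).congr_of_eventuallyEq ?_
        filter_upwards [hΩo.mem_nhds hx] with y hy
        exact Set.indicator_of_mem hy _
      simpa [hQ] using h1.hasLineDerivAt e
    · rw [Set.indicator_of_notMem hx]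
      have h1 : HasFDerivAt (Ω.indicator P) (0 : EuclideanSpace ℝ (Fin d) →L[ℝ] ℝ) x := by
        by_cases hc : x ∈ closure Ω
        · have hfr : x ∈ frontier Ω := by
            rw [hΩo.frontier_eq]; exact ⟨hc, hx⟩
          have h2 := hD x
          rw [f0 x hfr, g0 x hfr, zero_smul, zero_smul, add_zero] at h2
          rw [hasFDerivAt_iff_isLittleO] at h2 ⊢
          refine Asymptotics.IsBigO.trans_isLittleO ?_ h2
          refine Asymptotics.isBigO_of_le _ fun y => ?_
          have hPx : P x = 0 := by simp [hP, f0 x hfr]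
          simp only [Set.indicator_of_notMem hx, hPx, sub_zero, zero_apply]
          exact norm_indicator_le_norm_self _ _
        · refine (hasFDerivAt_const (0 : ℝ) x).congr_of_eventuallyEq ?_
          filter_upwards [isClosed_closure.isOpen_compl.mem_nhds hc] with y hy
          exact Set.indicator_of_notMem (fun h => hy (subset_closure h)) _
      simpa using h1.hasLineDerivAt e
  have hPi : Integrable (Ω.indicator P) :=
    (hbig P (hf.continuous.mul hg.continuous)).integrable_indicator hΩo.measurableSet
  have hQi : Integrable (Ω.indicator Q) :=
    (hbig Q ((hf.continuous.mul hcg').add (hg.continuous.mul hcf'))).integrable_indicator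
      hΩo.measurableSet
  have := integral_bilinear_hasLineDerivAt_right_eq_neg_left_of_integrable
    (μ := (volume : Measure (EuclideanSpace ℝ (Fin d)))) (v := e)
    (f := fun _ => (1:ℝ)) (f' := fun _ => (0:ℝ)) (g := Ω.indicator P) (g' := Ω.indicator Q)
    (B := ContinuousLinearMap.mul ℝ ℝ) (by simp) (by simpa using hQi) (by simpa using hPi)
    (fun x _ => (hasFDerivAt_const (1 : ℝ) x).hasLineDerivAt e) (fun x _ => hline x)
  simpa [integral_indicator hΩo.measurableSet] using this

lemma cs18 {d : ℕ} (w : Fin d → ℝ) (S : Fin d → Fin d → ℝ) :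
    |∑ i, ∑ j, w i * w j * S i j| ≤ Real.sqrt (∑ i, ∑ j, S i j ^ 2) * ∑ i, w i ^ 2 := by
  have hW : 0 ≤ ∑ i, w i ^ 2 := Finset.sum_nonneg fun i _ => sq_nonneg _
  have h := Finset.sum_mul_sq_le_sq_mul_sq (Finset.univ : Finset (Fin d × Fin d))
    (fun p => w p.1 * w p.2) (fun p => S p.1 p.2)
  simp only [Fintype.sum_prod_type] at h
  have h2 : ∑ i, ∑ j, (w i * w j) ^ 2 = (∑ i, w i ^ 2) ^ 2 := by
    rw [sq (∑ i, w i ^ 2), Finset.sum_mul_sum]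
    simp only [mul_pow]
  rw [h2] at h
  have h3 := Real.abs_le_sqrt h
  rw [Real.sqrt_mul (sq_nonneg _), Real.sqrt_sq hW, mul_comm] at h3
  exact h3

/-- For smooth divergence-free vector fields `u, v` on a bounded domain `Ω`,
vanishing on `∂Ω`, one has
`∫_Ω [(u⊗u):∇v + (v⊗v):∇u] = ∫_Ω ((u-v)⊗(u-v)):(∇v)_sym`, and hence
`|∫_Ω [(u⊗u):∇v + (v⊗v):∇u]| ≤ ‖(∇v)_sym‖_{L^∞(Ω)} ‖u - v‖²_{L²(Ω)}`. -/
theorem stmt18 (d : ℕ) (Ω : Set (EuclideanSpace ℝ (Fin d)))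
    (hΩo : IsOpen Ω) (hΩb : Bornology.IsBounded Ω)
    (u v : EuclideanSpace ℝ (Fin d) → EuclideanSpace ℝ (Fin d))
    (hu : ContDiff ℝ (⊤ : ℕ∞) u) (hv : ContDiff ℝ (⊤ : ℕ∞) v)
    (Du Dv Sv : EuclideanSpace ℝ (Fin d) → Fin d → Fin d → ℝ)
    (hDu : Du = fun x i j => fderiv ℝ u x (EuclideanSpace.single i 1) j)
    (hDv : Dv = fun x i j => fderiv ℝ v x (EuclideanSpace.single i 1) j)
    (hSv : Sv = fun x i j => (Dv x i j + Dv x j i) / 2)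
    (hdivu : ∀ x ∈ Ω, ∑ i, Du x i i = 0)
    (hdivv : ∀ x ∈ Ω, ∑ i, Dv x i i = 0)
    (hbdryu : ∀ x ∈ frontier Ω, u x = 0)
    (hbdryv : ∀ x ∈ frontier Ω, v x = 0) :
    (∫ x in Ω, (∑ i, ∑ j, (u x i * u x j * Dv x i j + v x i * v x j * Du x i j)))
      = ∫ x in Ω, (∑ i, ∑ j, (u x i - v x i) * (u x j - v x j) * Sv x i j) ∧
    ∀ K : ℝ, (∀ x ∈ Ω, Real.sqrt (∑ i, ∑ j, (Sv x i j) ^ 2) ≤ K) →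
      |∫ x in Ω, (∑ i, ∑ j, (u x i * u x j * Dv x i j + v x i * v x j * Du x i j))|
        ≤ K * ∫ x in Ω, (∑ i, (u x i - v x i) ^ 2) := by
  have hu1 : ContDiff ℝ 1 u := hu.of_le (by exact_mod_cast le_top)
  have hv1 : ContDiff ℝ 1 v := hv.of_le (by exact_mod_cast le_top)
  have huc : ∀ i, ContDiff ℝ 1 fun x => u x i := fun i => (contDiff_euclidean.1 hu1) i
  have hvc : ∀ i, ContDiff ℝ 1 fun x => v x i := fun i => (contDiff_euclidean.1 hv1) i
  have hfd : ∀ w : EuclideanSpace ℝ (Fin d) → EuclideanSpace ℝ (Fin d), ContDiff ℝ 1 w →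
      ∀ x j, HasFDerivAt (fun y => w y j)
        ((EuclideanSpace.proj j : EuclideanSpace ℝ (Fin d) →L[ℝ] ℝ).comp (fderiv ℝ w x)) x := by
    intro w hw x j
    exact (EuclideanSpace.proj j : EuclideanSpace ℝ (Fin d) →L[ℝ] ℝ).hasFDerivAt.comp x
      ((hw.differentiable one_ne_zero) x).hasFDerivAt
  have hU : ∀ x i j, fderiv ℝ (fun y => u y j) x (EuclideanSpace.single i 1) = Du x i j := by
    intro x i j
    rw [(hfd u hu1 x j).fderiv, hDu]; rfl
  have hV : ∀ x i j, fderiv ℝ (fun y => v y j) x (EuclideanSpace.single i 1) = Dv x i j := by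
    intro x i j
    rw [(hfd v hv1 x j).fderiv, hDv]; rfl
  have cDu : ∀ i j, Continuous fun x => Du x i j := by
    intro i j
    simp only [← hU]
    exact ((huc j).continuous_fderiv one_ne_zero).clm_apply continuous_const
  have cDv : ∀ i j, Continuous fun x => Dv x i j := by
    intro i j
    simp only [← hV]
    exact ((hvc j).continuous_fderiv one_ne_zero).clm_apply continuous_const
  have cSv : ∀ i j, Continuous fun x => Sv x i j := by
    intro i j
    rw [hSv]
    exact ((cDv i j).add (cDv j i)).div_const 2
  have cu : ∀ i, Continuous fun x => u x i := fun i => (huc i).continuous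
  have cv : ∀ i, Continuous fun x => v x i := fun i => (hvc i).continuous
  have hint : ∀ h : EuclideanSpace ℝ (Fin d) → ℝ, Continuous h → IntegrableOn h Ω := by
    intro h hc
    exact (hc.continuousOn.integrableOn_compact hΩb.isCompact_closure).mono_set subset_closure
  have dU : ∀ j x, DifferentiableAt ℝ (fun y => u y j) x :=
    fun j x => (huc j).differentiable one_ne_zero x
  have dV : ∀ j x, DifferentiableAt ℝ (fun y => v y j) x :=
    fun j x => (hvc j).differentiable one_ne_zero x
  have k1 : ∀ i j, ∫ x in Ω, (v x i * (u x j * Dv x i j + v x j * Du x i j)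
      + u x j * v x j * Dv x i i) = 0 := by
    intro i j
    have := key18 hΩo hΩb (fun x => v x i) (fun x => u x j * v x j) (hvc i)
      ((huc j).mul (hvc j)) (fun x hx => by simp [hbdryv x hx])
      (fun x hx => by simp [hbdryv x hx]) (EuclideanSpace.single i 1)
    rw [← this]
    congr 1
    funext x
    rw [fderiv_fun_mul (dU j x) (dV j x)]
    simp [hU, hV]
  have k2 : ∀ i j, ∫ x in Ω, ((u x i - v x i) * (v x j * Dv x i j + v x j * Dv x i j)
      + v x j * v x j * (Du x i i - Dv x i i)) = 0 := by
    intro i j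
    have := key18 hΩo hΩb (fun x => u x i - v x i) (fun x => v x j * v x j)
      ((huc i).sub (hvc i))
      ((hvc j).mul (hvc j)) (fun x hx => by simp [hbdryv x hx, hbdryu x hx])
      (fun x hx => by simp [hbdryv x hx]) (EuclideanSpace.single i 1)
    rw [← this]
    congr 1
    funext x
    rw [fderiv_fun_mul (dV j x) (dV j x), fderiv_fun_sub (dU i x) (dV i x)]
    simp [hU, hV]
  set T : Fin d → Fin d → EuclideanSpace ℝ (Fin d) → ℝ := fun i j x =>
    (v x i * (u x j * Dv x i j + v x j * Du x i j) + u x j * v x j * Dv x i i)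
    + (1/2) * ((u x i - v x i) * (v x j * Dv x i j + v x j * Dv x i j)
      + v x j * v x j * (Du x i i - Dv x i i)) with hT
  have iT : ∀ i j, IntegrableOn (T i j) Ω := fun i j => hint _ (by fun_prop)
  have T0 : ∀ i j, ∫ x in Ω, T i j x = 0 := by
    intro i j
    simp only [hT]
    rw [integral_add (hint _ (by fun_prop)) ((hint _ (by fun_prop)).const_mul _),
      integral_const_mul, k1, k2]
    simp
  have TS : ∫ x in Ω, ∑ i, ∑ j, T i j x = 0 := by
    rw [integral_finsetSum _ fun i _ => integrable_finsetSum _ fun j _ => iT i j]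
    refine Finset.sum_eq_zero fun i _ => ?_
    rw [integral_finsetSum _ fun j _ => iT i j]
    exact Finset.sum_eq_zero fun j _ => T0 i j
  have hsym : ∀ x, ∑ i, ∑ j, (u x i - v x i) * (u x j - v x j) * Sv x i j
      = ∑ i, ∑ j, (u x i - v x i) * (u x j - v x j) * Dv x i j := by
    intro x
    have h1 : ∑ i, ∑ j, (u x i - v x i) * (u x j - v x j) * Dv x j i
        = ∑ i, ∑ j, (u x i - v x i) * (u x j - v x j) * Dv x i j := by
      rw [Finset.sum_comm]
      refine Finset.sum_congr rfl fun i _ => Finset.sum_congr rfl fun j _ => by ring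
    have h2 : ∑ i, ∑ j, (u x i - v x i) * (u x j - v x j) * Sv x i j
        = (∑ i, ∑ j, (u x i - v x i) * (u x j - v x j) * Dv x i j
          + ∑ i, ∑ j, (u x i - v x i) * (u x j - v x j) * Dv x j i) / 2 := by
      simp only [← Finset.sum_add_distrib, Finset.sum_div, hSv]
      refine Finset.sum_congr rfl fun i _ => Finset.sum_congr rfl fun j _ => by ring
    rw [h2, h1]; ring
  have main : (∫ x in Ω, (∑ i, ∑ j, (u x i * u x j * Dv x i j + v x i * v x j * Du x i j)))
      = ∫ x in Ω, (∑ i, ∑ j, (u x i - v x i) * (u x j - v x j) * Sv x i j) := by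
    rw [← add_zero (∫ x in Ω, (∑ i, ∑ j, (u x i - v x i) * (u x j - v x j) * Sv x i j)), ← TS,
      ← integral_add (hint _ (by fun_prop)) (hint _ (by fun_prop))]
    refine setIntegral_congr_fun hΩo.measurableSet fun x hx => ?_
    have e1 : ∑ i, ∑ j, u x j * v x j * Dv x i i = 0 := by
      rw [Finset.sum_comm]
      simp only [← Finset.mul_sum, hdivv x hx, mul_zero, Finset.sum_const_zero]
    have e2 : ∑ i, ∑ j, v x j * v x j * (Du x i i - Dv x i i) = 0 := by
      rw [Finset.sum_comm]
      simp only [← Finset.mul_sum, Finset.sum_sub_distrib, hdivv x hx, hdivu x hx, sub_zero,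
        mul_zero, Finset.sum_const_zero]
    have e3 : ∑ i, ∑ j, (u x i * u x j * Dv x i j + v x i * v x j * Du x i j)
        + ∑ i, ∑ j, u x j * v x j * Dv x i i
        + (1/2) * ∑ i, ∑ j, v x j * v x j * (Du x i i - Dv x i i)
        = ∑ i, ∑ j, (u x i - v x i) * (u x j - v x j) * Dv x i j + ∑ i, ∑ j, T i j x := by
      simp only [Finset.mul_sum, ← Finset.sum_add_distrib, hT]
      refine Finset.sum_congr rfl fun i _ => Finset.sum_congr rfl fun j _ => by ring
    rw [e1, e2] at e3
    simp only [hsym]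
    linarith
  refine ⟨main, fun K hK => ?_⟩
  rw [main, ← integral_const_mul, ← Real.norm_eq_abs]
  refine norm_integral_le_of_norm_le ((hint _ (by fun_prop)).const_mul K) ?_
  refine (ae_restrict_iff' hΩo.measurableSet).2 (Filter.Eventually.of_forall fun x hx => ?_)
  rw [Real.norm_eq_abs]
  exact (cs18 (fun i => u x i - v x i) (Sv x)).trans
    (mul_le_mul_of_nonneg_right (hK x hx) (Finset.sum_nonneg fun i _ => sq_nonneg _))
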